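/- Fix N, T ∈ ℕ, coefficients β, η ∈ ℝ, a neighbor relation Nb on {1,…,N}, α ∈ ℝ, ψ > 0, and initial wildlife w⁰ ∈ [0,∞)^N. Let Π = ([0,1]^N)^T be the set of open-loop policies and let Z ⊆ ℝ^N be nonempty and compact. Let r(π, θ) be the expected return of policy π under parameters θ (the finite sum over attack realizations of the probability-weighted total final wildlife under the logistic attack model and the max(0, w^ψ − α·k·(1−a)) wildlife recursion, starting from w⁰). Then the max-regret game payoff payoff(π, θ) = r(π, θ) − max_{π' ∈ Π} r(π', θ) is well defined and jointly continuous on Π × Z, and both strategy spaces Π and Z are nonempty and compact; i.e., the induced max-regret game is a continuous game. -/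

import Mathlib

/-- The logistic function `σ(x) = 1 / (1 + e^{-x})`. -/
noncomputable def logistic (x : ℝ) : ℝ := (1 + Real.exp (-x))⁻¹

/-- Attack probability at target `i`: `σ(θ_i + β·a_i + η·∑_{j ∈ Nb i} a_j)`. -/
noncomputable def attackProb {N : ℕ} (β η : ℝ) (Nb : Fin N → Finset (Fin N))
    (θ a : Fin N → ℝ) (i : Fin N) : ℝ :=
  logistic (θ i + β * a i + η * ∑ j ∈ Nb i, a j)

/-- The effort `a^(t-1)` preceding step `t` (0-based), with `a^(0) = 0`. -/
def prevEffort {N T : ℕ} (π : Fin T → Fin N → ℝ) (t : Fin T) : Fin N → ℝ :=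
  if 0 < t.val then π ⟨t.val - 1, by have := t.isLt; omega⟩ else 0

/-- Wildlife trajectory `w^(t)`:
`w_i^(t) = max(0, (w_i^(t-1))^ψ − α·k_i^(t)·(1 − a_i^(t)))`. -/
noncomputable def wildlifeTraj {N T : ℕ} (α ψ : ℝ) (π : Fin T → Fin N → ℝ)
    (w0 : Fin N → ℝ) (k : Fin T → Fin N → Bool) : ℕ → Fin N → ℝ
  | 0 => w0
  | t + 1 => fun i =>
      if h : t < T then
        max 0 ((wildlifeTraj α ψ π w0 k t i) ^ ψ -
          α * (if k ⟨t, h⟩ i then (1 : ℝ) else 0) * (1 - π ⟨t, h⟩ i))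
      else wildlifeTraj α ψ π w0 k t i

/-- Probability of the attack realization `k`. -/
noncomputable def realizationProb {N T : ℕ} (β η : ℝ) (Nb : Fin N → Finset (Fin N))
    (θ : Fin N → ℝ) (π : Fin T → Fin N → ℝ) (k : Fin T → Fin N → Bool) : ℝ :=
  ∏ t : Fin T, ∏ i : Fin N,
    (if k t i then attackProb β η Nb θ (prevEffort π t) i
     else 1 - attackProb β η Nb θ (prevEffort π t) i)

/-- Expected return: expectation over attack realizations of total final wildlife. -/
noncomputable def expectedReturn {N T : ℕ} (β η : ℝ) (Nb : Fin N → Finset (Fin N))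
    (α ψ : ℝ) (π : Fin T → Fin N → ℝ) (θ : Fin N → ℝ) (w0 : Fin N → ℝ) : ℝ :=
  ∑ k : Fin T → Fin N → Bool,
    realizationProb β η Nb θ π k * ∑ i : Fin N, wildlifeTraj α ψ π w0 k T i

/-- The open-loop policy space `Π = ([0,1]^N)^T`. -/
def policySet (N T : ℕ) : Set (Fin T → Fin N → ℝ) :=
  Set.univ.pi fun _ : Fin T => Set.univ.pi fun _ : Fin N => Set.Icc (0 : ℝ) 1

/-- The max-regret game payoff `payoff(π, θ) = r(π, θ) − max_{π' ∈ Π} r(π', θ)`. -/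
noncomputable def maxRegretPayoff {N T : ℕ} (β η : ℝ) (Nb : Fin N → Finset (Fin N))
    (α ψ : ℝ) (w0 : Fin N → ℝ) (π : Fin T → Fin N → ℝ) (θ : Fin N → ℝ) : ℝ :=
  expectedReturn β η Nb α ψ π θ w0 -
    sSup {z : ℝ | ∃ π' ∈ policySet N T, z = expectedReturn β η Nb α ψ π' θ w0}

theorem continuous_logistic : Continuous logistic := by
  unfold logistic
  exact Continuous.inv₀ (by fun_prop) fun x => by positivity

theorem continuous_prevEffort {N T : ℕ} (t : Fin T) :
    Continuous fun π : Fin T → Fin N → ℝ => prevEffort π t := by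
  unfold prevEffort
  split_ifs
  · exact continuous_apply _
  · exact continuous_const

theorem continuous_attackProb {N : ℕ} (β η : ℝ) (Nb : Fin N → Finset (Fin N)) (i : Fin N) :
    Continuous fun q : (Fin N → ℝ) × (Fin N → ℝ) => attackProb β η Nb q.1 q.2 i := by
  unfold attackProb
  exact continuous_logistic.comp (by fun_prop)

theorem continuous_wildlifeTraj {N T : ℕ} (α : ℝ) {ψ : ℝ} (hψ : 0 ≤ ψ) (w0 : Fin N → ℝ)
    (k : Fin T → Fin N → Bool) (t : ℕ) :
    Continuous fun π : Fin T → Fin N → ℝ => wildlifeTraj α ψ π w0 k t := by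
  induction t with
  | zero => exact continuous_const
  | succ t ih =>
    refine continuous_pi fun i => ?_
    have hi : Continuous fun π : Fin T → Fin N → ℝ => wildlifeTraj α ψ π w0 k t i :=
      (continuous_apply i).comp ih
    by_cases h : t < T
    · simp only [wildlifeTraj, h, dite_true]
      have hpow := hi.rpow_const (p := ψ) fun _ => Or.inr hψ
      fun_prop
    · simpa only [wildlifeTraj, h, dite_false] using hi

theorem continuous_realizationProb {N T : ℕ} (β η : ℝ) (Nb : Fin N → Finset (Fin N))
    (k : Fin T → Fin N → Bool) :
    Continuous fun q : (Fin T → Fin N → ℝ) × (Fin N → ℝ) =>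
      realizationProb β η Nb q.2 q.1 k := by
  unfold realizationProb
  refine continuous_finsetProd _ fun t _ => continuous_finsetProd _ fun i _ => ?_
  have hp : Continuous fun q : (Fin T → Fin N → ℝ) × (Fin N → ℝ) =>
      attackProb β η Nb q.2 (prevEffort q.1 t) i :=
    (continuous_attackProb β η Nb i).comp
      (continuous_snd.prodMk ((continuous_prevEffort t).comp continuous_fst))
  split_ifs
  · exact hp
  · exact continuous_const.sub hp

theorem continuous_expectedReturn {N T : ℕ} (β η : ℝ) (Nb : Fin N → Finset (Fin N))
    (α : ℝ) {ψ : ℝ} (hψ : 0 ≤ ψ) (w0 : Fin N → ℝ) :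
    Continuous fun q : (Fin T → Fin N → ℝ) × (Fin N → ℝ) =>
      expectedReturn β η Nb α ψ q.1 q.2 w0 := by
  unfold expectedReturn
  refine continuous_finsetSum _ fun k _ => (continuous_realizationProb β η Nb k).mul ?_
  exact continuous_finsetSum _ fun i _ =>
    (continuous_apply i).comp ((continuous_wildlifeTraj α hψ w0 k T).comp continuous_fst)

theorem continuous_sSup_image_of_isCompact {X Y : Type*} [TopologicalSpace X]
    [TopologicalSpace Y] {f : X → Y → ℝ} {K : Set X} (hK : IsCompact K)
    (hf : Continuous fun q : X × Y => f q.1 q.2) :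
    Continuous fun y => sSup ((fun x => f x y) '' K) :=
  hK.continuous_sSup (f := fun y x => f x y) (hf.comp continuous_swap)

theorem policySet_nonempty (N T : ℕ) : (policySet N T).Nonempty :=
  ⟨0, fun _ _ _ _ => ⟨le_rfl, zero_le_one⟩⟩

theorem isCompact_policySet (N T : ℕ) : IsCompact (policySet N T) :=
  isCompact_univ_pi fun _ => isCompact_univ_pi fun _ => isCompact_Icc

/-- the induced max-regret game is a continuous game: both
strategy spaces are nonempty and compact, the inner maximum defining the
payoff is attained (so the payoff is well defined), and the payoff is jointly
continuous on `Π × Z`. -/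
theorem maxRegretGame_isContinuousGame
    {N T : ℕ} (β η : ℝ) (Nb : Fin N → Finset (Fin N)) (α ψ : ℝ) (hψ : 0 < ψ)
    (w0 : Fin N → ℝ) (hw0 : ∀ i, 0 ≤ w0 i)
    (Z : Set (Fin N → ℝ)) (hZne : Z.Nonempty) (hZcpt : IsCompact Z) :
    (policySet N T).Nonempty ∧ IsCompact (policySet N T) ∧
    (∀ θ ∈ Z, ∃ πopt ∈ policySet N T,
      expectedReturn β η Nb α ψ πopt θ w0 =
        sSup {z : ℝ | ∃ π' ∈ policySet N T, z = expectedReturn β η Nb α ψ π' θ w0} ∧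
      ∀ π' ∈ policySet N T,
        expectedReturn β η Nb α ψ π' θ w0 ≤ expectedReturn β η Nb α ψ πopt θ w0) ∧
    ContinuousOn
      (fun q : (Fin T → Fin N → ℝ) × (Fin N → ℝ) =>
        maxRegretPayoff β η Nb α ψ w0 q.1 q.2)
      (policySet N T ×ˢ Z) := by
  have hr := continuous_expectedReturn (T := T) β η Nb α hψ.le w0
  have himage : ∀ θ, {z : ℝ | ∃ π' ∈ policySet N T, z = expectedReturn β η Nb α ψ π' θ w0} =
      (fun π' => expectedReturn β η Nb α ψ π' θ w0) '' policySet N T := fun θ => by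
    ext z
    simp only [Set.mem_ofPred_eq, Set.mem_image, eq_comm]
  refine ⟨policySet_nonempty N T, isCompact_policySet N T, fun θ _ => ?_, ?_⟩
  · obtain ⟨πopt, hmem, hsup, hmax⟩ :=
      (isCompact_policySet N T).exists_sSup_image_eq_and_ge (policySet_nonempty N T)
        (hr.comp (Continuous.prodMk_left θ)).continuousOn
    refine ⟨πopt, hmem, ?_, hmax⟩
    rw [himage]
    exact hsup.symm
  · refine Continuous.continuousOn ?_
    simp only [maxRegretPayoff, himage]
    have hsup := continuous_sSup_image_of_isCompact
      (f := fun π θ => expectedReturn β η Nb α ψ π θ w0) (isCompact_policySet N T) hr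
    exact hr.sub (hsup.comp continuous_snd)
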